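/- Explicit characterization of the stopping region for a stopping-time POMDP: assume additionally Σ_y B_{iy} = 1 for every state i and initialize the value iteration with V₀(π) = c₁ᵀπ. Define S° = {π in the probability simplex : c₁ᵀπ ≤ c₂ᵀπ + c₁ᵀPᵀπ}. If S° is invariant under the filter update, i.e., π ∈ S° implies T(π,y) ∈ S° for every observation y, then V_n(π) = c₁ᵀπ for every n ≥ 0 and every π ∈ S°. -/

import Mathlib

/-- The HMM filter normalization `σ(π,y) = Σ_m B_{my} (Pᵀπ)_m`. -/
noncomputable def hmmSigma {X : ℕ} {Y : Type*}
    (P : Matrix (Fin X) (Fin X) ℝ) (B : Fin X → Y → ℝ) (π : Fin X → ℝ) (y : Y) : ℝ :=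
  ∑ m, B m y * P.transpose.mulVec π m

/-- The HMM filter update `T(π,y)_j = B_{jy}(Pᵀπ)_j / σ(π,y)`. -/
noncomputable def hmmFilter {X : ℕ} {Y : Type*}
    (P : Matrix (Fin X) (Fin X) ℝ) (B : Fin X → Y → ℝ) (π : Fin X → ℝ) (y : Y) :
    Fin X → ℝ :=
  fun j => B j y * P.transpose.mulVec π j / hmmSigma P B π y

/-- The stopping-time POMDP value iteration
`V_{n+1}(π) = min{c₁ᵀπ, c₂ᵀπ + Σ_y V_n(T(π,y)) σ(π,y)}`, initialized with `V₀(π) = c₁ᵀπ`. -/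
noncomputable def valueIter {X : ℕ} {Y : Type*} [Fintype Y]
    (P : Matrix (Fin X) (Fin X) ℝ) (B : Fin X → Y → ℝ) (c₁ c₂ : Fin X → ℝ) :
    ℕ → (Fin X → ℝ) → ℝ
  | 0 => fun π => ∑ i, c₁ i * π i
  | n + 1 => fun π =>
      min (∑ i, c₁ i * π i)
        (∑ i, c₂ i * π i +
          ∑ y, valueIter P B c₁ c₂ n (hmmFilter P B π y) * hmmSigma P B π y)

/-- The candidate stopping set
`S° = {π ∈ simplex : c₁ᵀπ ≤ c₂ᵀπ + c₁ᵀPᵀπ}`. -/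
def stopSet {X : ℕ} (P : Matrix (Fin X) (Fin X) ℝ) (c₁ c₂ : Fin X → ℝ) :
    Set (Fin X → ℝ) :=
  {π | (∀ i, 0 ≤ π i) ∧ (∑ i, π i = 1) ∧
    ∑ i, c₁ i * π i ≤ ∑ i, c₂ i * π i + ∑ i, c₁ i * P.transpose.mulVec π i}

/-- If `S°` is invariant under the filter update, then the value iteration (initialized with
`V₀(π) = c₁ᵀπ`) satisfies `V_n(π) = c₁ᵀπ` on `S°` for every `n`. -/
theorem stmt_16 (X : ℕ) (Y : Type*) [Fintype Y]
    (P : Matrix (Fin X) (Fin X) ℝ)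
    (hPnn : ∀ i j, 0 ≤ P i j) (hProw : ∀ i, ∑ j, P i j = 1)
    (B : Fin X → Y → ℝ) (hB : ∀ i y, 0 < B i y) (hBrow : ∀ i, ∑ y, B i y = 1)
    (c₁ c₂ : Fin X → ℝ) (hc₁ : ∀ i, 0 ≤ c₁ i) (hc₂ : ∀ i, 0 ≤ c₂ i)
    (hinv : ∀ π ∈ stopSet P c₁ c₂, ∀ y : Y, hmmFilter P B π y ∈ stopSet P c₁ c₂) :
    ∀ n : ℕ, ∀ π ∈ stopSet P c₁ c₂, valueIter P B c₁ c₂ n π = ∑ i, c₁ i * π i := by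
  intro n
  induction n with
  | zero => intro π _; simp [valueIter]
  | succ n ih =>
    intro π hπ
    have key : ∑ y, valueIter P B c₁ c₂ n (hmmFilter P B π y) * hmmSigma P B π y
        = ∑ i, c₁ i * P.transpose.mulVec π i := by
      have h1 : ∀ y, valueIter P B c₁ c₂ n (hmmFilter P B π y) * hmmSigma P B π y
          = ∑ i, B i y * (c₁ i * P.transpose.mulVec π i) := by
        intro y
        have hmem := hinv π hπ y
        have hne : hmmSigma P B π y ≠ 0 := by
          intro h0
          have h2 := hmem.2.1
          simp [hmmFilter, h0] at h2
        rw [ih _ hmem, Finset.sum_mul]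
        refine Finset.sum_congr rfl fun i _ => ?_
        unfold hmmFilter
        field_simp
      simp_rw [h1]
      rw [Finset.sum_comm]
      refine Finset.sum_congr rfl fun i _ => ?_
      rw [← Finset.sum_mul, hBrow, one_mul]
    simp only [valueIter]
    rw [key]
    exact min_eq_left hπ.2.2
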